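/- Let p ≥ 2. There is no vector field V : B² → ℝ² with ∫_{B²} ‖V‖^p dx < ∞ whose distributional divergence equals 2π times the Dirac mass at the origin; i.e., there is no such V satisfying ∫_{B²} ⟨V(x), ∇φ(x)⟩ dx = −2π φ(0) for every smooth compactly supported φ : ℝ² → ℝ with support contained in B². -/

import Mathlib

open MeasureTheory Metric Real RealInnerProductSpace

/-- The gradient bound for the rescaled bump function. -/
lemma scaled_grad_bound (f : EuclideanSpace ℝ (Fin 2) → ℝ)
    (C : ℝ) (hC : ∀ x, ‖fderiv ℝ f x‖ ≤ C) (N : ℝ) (hN : 0 < N)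
    (x : EuclideanSpace ℝ (Fin 2)) :
    ‖gradient (fun y => f (N • y)) x‖ ≤ N * C := by
  have h1 : ‖gradient (fun y => f (N • y)) x‖ = ‖fderiv ℝ (fun y => f (N • y)) x‖ := by
    simp [gradient]
  have h2 : fderiv ℝ (fun y => f (N • y)) x = N • fderiv ℝ f (N • x) := by
    rw [fderiv_comp_smul]
  rw [h1, h2, norm_smul, Real.norm_eq_abs, abs_of_pos hN]
  exact mul_le_mul_of_nonneg_left (hC _) hN.le

lemma tsupport_scaled (f : EuclideanSpace ℝ (Fin 2) → ℝ)
    (hs : ∀ x, f x ≠ 0 → ‖x‖ ≤ 1 / 2) (N : ℝ) (hN : 0 < N) :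
    tsupport (fun y => f (N • y)) ⊆ closedBall 0 (1 / (2 * N)) := by
  refine closure_minimal ?_ isClosed_closedBall
  intro x hx
  have h := hs _ hx
  rw [norm_smul, Real.norm_eq_abs, abs_of_pos hN] at h
  rw [mem_closedBall_zero_iff, le_div_iff₀ (by positivity)]
  linarith

/-- For `p ≥ 2` there is no vector field `V` on the unit ball `B²` with
`∫_{B²} ‖V‖^p < ∞` whose distributional divergence is `2π` times the Dirac mass at
the origin, i.e. no integrable `V` with `∫ ⟨V, ∇φ⟩ = −2π φ(0)` for all smooth
compactly supported `φ` with support in `B²`. -/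
theorem no_Lp_field_with_dirac_divergence (p : ℝ) (hp : 2 ≤ p) :
    ¬ ∃ V : EuclideanSpace ℝ (Fin 2) → EuclideanSpace ℝ (Fin 2),
        IntegrableOn V (ball (0 : EuclideanSpace ℝ (Fin 2)) 1) volume ∧
        IntegrableOn (fun x => ‖V x‖ ^ p) (ball (0 : EuclideanSpace ℝ (Fin 2)) 1)
          volume ∧
        (∀ φ : EuclideanSpace ℝ (Fin 2) → ℝ, ContDiff ℝ (⊤ : ℕ∞) φ → HasCompactSupport φ →
          tsupport φ ⊆ ball (0 : EuclideanSpace ℝ (Fin 2)) 1 →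
          (∫ x in ball (0 : EuclideanSpace ℝ (Fin 2)) 1, ⟪V x, gradient φ x⟫)
            = -(2 * π * φ 0)) := by
  rintro ⟨V, hV, hVp, H⟩
  have hV2 : IntegrableOn (fun x => ‖V x‖ ^ 2) (ball (0 : EuclideanSpace ℝ (Fin 2)) 1)
      volume := by
    have h1 : IntegrableOn (fun _ => (1 : ℝ)) (ball (0 : EuclideanSpace ℝ (Fin 2)) 1)
        volume := integrableOn_const (by exact measure_ball_lt_top.ne)
    refine Integrable.mono' (h1.add hVp) (hV.aestronglyMeasurable.norm.pow 2) ?_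
    refine Filter.Eventually.of_forall fun x => ?_
    simp only [Pi.add_apply]
    rw [Real.norm_of_nonneg (by positivity)]
    rcases le_total (‖V x‖) 1 with h | h
    · have : ‖V x‖ ^ 2 ≤ 1 := pow_le_one₀ (norm_nonneg _) h
      have : 0 ≤ ‖V x‖ ^ p := by positivity
      linarith
    · have : ‖V x‖ ^ (2 : ℝ) ≤ ‖V x‖ ^ p := Real.rpow_le_rpow_of_exponent_le h hp
      rw [Real.rpow_two] at this
      linarith
  let b : ContDiffBump (0 : EuclideanSpace ℝ (Fin 2)) := ⟨1 / 4, 1 / 2, by norm_num, by norm_num⟩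
  have hb : ContDiff ℝ (⊤ : ℕ∞) b := b.contDiff
  have hb0 : b 0 = 1 := b.one_of_mem_closedBall (by simp [b])
  have hbs : ∀ x, b x ≠ 0 → ‖x‖ ≤ 1 / 2 := by
    intro x hx
    have : x ∈ Function.support b := hx
    rw [b.support_eq, mem_ball_zero_iff] at this
    exact this.le
  obtain ⟨C, hC⟩ : ∃ C, ∀ x, ‖fderiv ℝ b x‖ ≤ C :=
    (b.hasCompactSupport.fderiv ℝ).exists_bound_of_continuous (hb.continuous_fderiv (by simp))
  have hC0 : 0 ≤ C := (norm_nonneg _).trans (hC 0)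
  have key : ∀ ε : ℝ, 0 < ε → ∀ r : ℝ, 0 < r → r ≤ 1 →
      2 * π ≤ ε⁻¹ * (∫ x in ball (0 : EuclideanSpace ℝ (Fin 2)) r, ‖V x‖ ^ 2)
        + ε * C ^ 2 * π := by
    intro ε hε r hr hr1
    have hN : 0 < r⁻¹ := inv_pos.2 hr
    have hts := tsupport_scaled b hbs r⁻¹ hN
    have hsub : closedBall (0 : EuclideanSpace ℝ (Fin 2)) (1 / (2 * r⁻¹)) ⊆ ball 0 r := by
      apply closedBall_subset_ball
      field_simp
      norm_num
    have hrsub : ball (0 : EuclideanSpace ℝ (Fin 2)) r ⊆ ball 0 1 := ball_subset_ball hr1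
    have hE := H (fun y => b (r⁻¹ • y)) (hb.comp (contDiff_const_smul _))
      (HasCompactSupport.of_support_subset_isCompact (isCompact_closedBall _ _)
        ((subset_tsupport _).trans hts)) (hts.trans (hsub.trans hrsub))
    simp only [smul_zero, hb0, mul_one] at hE
    have hi : IntegrableOn (fun x => ε⁻¹ * ‖V x‖ ^ 2) (ball 0 r) :=
      (hV2.mono_set hrsub).const_mul _
    have hc : IntegrableOn (fun _ => ε * (r⁻¹ * C) ^ 2)
        (ball (0 : EuclideanSpace ℝ (Fin 2)) r) volume :=
      integrableOn_const (by exact measure_ball_lt_top.ne)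
    have hind : Integrable ((ball (0 : EuclideanSpace ℝ (Fin 2)) r).indicator
        (fun x => ε⁻¹ * ‖V x‖ ^ 2 + ε * (r⁻¹ * C) ^ 2)) volume :=
      (integrable_indicator_iff measurableSet_ball).2 (hi.add hc)
    have hle := norm_integral_le_of_norm_le
      (μ := volume.restrict (ball (0 : EuclideanSpace ℝ (Fin 2)) 1))
      (f := fun x => ⟪V x, gradient (fun y => b (r⁻¹ • y)) x⟫)
      (g := (ball (0 : EuclideanSpace ℝ (Fin 2)) r).indicator
        (fun x => ε⁻¹ * ‖V x‖ ^ 2 + ε * (r⁻¹ * C) ^ 2))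
      hind.integrableOn
      (Filter.Eventually.of_forall (fun x => by
        by_cases hx : x ∈ ball (0 : EuclideanSpace ℝ (Fin 2)) r
        · rw [Set.indicator_of_mem hx]
          have h1 := norm_inner_le_norm (𝕜 := ℝ) (V x) (gradient (fun y => b (r⁻¹ • y)) x)
          have h2 := scaled_grad_bound b C hC r⁻¹ hN x
          have h3 := mul_le_mul_of_nonneg_left h2 (norm_nonneg (V x))
          refine (h1.trans h3).trans ?_
          generalize ‖V x‖ = a
          generalize r⁻¹ * C = c
          have h4 : ε⁻¹ * a ^ 2 + ε * c ^ 2 - a * c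
              = ε⁻¹ * ((a - ε * c / 2) ^ 2 + 3 / 4 * (ε * c) ^ 2) := by
            field_simp
            ring
          have h5 : 0 ≤ ε⁻¹ * ((a - ε * c / 2) ^ 2 + 3 / 4 * (ε * c) ^ 2) := by positivity
          linarith
        · rw [Set.indicator_of_notMem hx]
          have h0 : fderiv ℝ (fun y => b (r⁻¹ • y)) x = 0 :=
            fderiv_of_notMem_tsupport ℝ (fun h => hx (hsub (hts h)))
          simp [gradient, h0]))
    rw [hE, setIntegral_indicator measurableSet_ball, Set.inter_eq_self_of_subset_right hrsub,
      integral_add hi hc, integral_const_mul, setIntegral_const, norm_neg,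
      Real.norm_of_nonneg (by positivity)] at hle
    have hvol : volume.real (ball (0 : EuclideanSpace ℝ (Fin 2)) r) = r ^ 2 * π := by
      rw [measureReal_def, EuclideanSpace.volume_ball_fin_two]
      simp [ENNReal.toReal_ofReal hr.le, Real.pi_pos.le]
    rw [hvol, smul_eq_mul] at hle
    have : r ^ 2 * π * (ε * (r⁻¹ * C) ^ 2) = ε * C ^ 2 * π := by field_simp
    linarith
  have hlim : Filter.Tendsto (fun n : ℕ => ∫ x in ball (0 : EuclideanSpace ℝ (Fin 2))
      (1 / ((n : ℝ) + 1)), ‖V x‖ ^ 2) Filter.atTop (nhds 0) := by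
    have ha : Antitone (fun n : ℕ => ball (0 : EuclideanSpace ℝ (Fin 2)) (1 / ((n : ℝ) + 1))) :=
      fun m n h => ball_subset_ball (Nat.one_div_le_one_div h)
    have h := tendsto_setIntegral_of_antitone (μ := volume) (f := fun x => ‖V x‖ ^ 2)
      (s := fun n : ℕ => ball (0 : EuclideanSpace ℝ (Fin 2)) (1 / ((n : ℝ) + 1)))
      (fun _ => measurableSet_ball) ha ⟨0, by simpa using hV2⟩
    have h0 : (⋂ n : ℕ, ball (0 : EuclideanSpace ℝ (Fin 2)) (1 / ((n : ℝ) + 1))) ⊆ {0} := by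
      intro x hx
      simp only [Set.mem_iInter, mem_ball_zero_iff] at hx
      by_contra hne
      obtain ⟨n, hn⟩ := exists_nat_one_div_lt (norm_pos_iff.2 hne)
      exact lt_asymm hn (hx n)
    rwa [setIntegral_measure_zero _ (measure_mono_null h0 (measure_singleton _))] at h
  have hfin : ∀ ε : ℝ, 0 < ε → 2 * π ≤ ε * C ^ 2 * π := by
    intro ε hε
    have h := (hlim.const_mul ε⁻¹).add_const (ε * C ^ 2 * π)
    rw [mul_zero, zero_add] at h
    refine ge_of_tendsto' h fun n => key ε hε _ (by positivity) ?_
    rw [div_le_one (by positivity)]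
    have : (0 : ℝ) ≤ n := Nat.cast_nonneg n
    linarith
  have h := hfin (1 / (C ^ 2 + 1)) (by positivity)
  have h2 : 1 / (C ^ 2 + 1) * C ^ 2 ≤ 1 := by
    rw [one_div_mul_eq_div, div_le_one (by positivity)]
    linarith
  nlinarith [Real.pi_pos]
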